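/- The real space ℓ₁ of absolutely summable sequences has the approximate hyperplane sum property for ℓ∞⁴, i.e., there exists a function γ : (0,1) → (0,1) with 0 < γ(ε) < ε such that ℓ₁ has the AHSp-ℓ∞⁴ with γ. -/

import Mathlib

/-- `M_Y^4`: quadruples `(y₁,y₂,y₃,y₄)` in the closed unit ball of `Y` such that
`‖y_{i₁} − y_{i₂} + y_{i₃}‖ ≤ 1` for all `i₁ < i₂ < i₃`. -/
def MY4 {Y : Type*} [NormedAddCommGroup Y] (y : Fin 4 → Y) : Prop :=
  (∀ i, ‖y i‖ ≤ 1) ∧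
    ∀ i j k : Fin 4, i < j → j < k → ‖y i - y j + y k‖ ≤ 1

/-- `Y` has the approximate hyperplane sum property for `ℓ∞⁴` with the function `γ`. -/
def AHSpL4With (Y : Type*) [NormedAddCommGroup Y] [NormedSpace ℝ Y] (γ : ℝ → ℝ) : Prop :=
  ∀ ε : ℝ, 0 < ε → ε < 1 →
    (0 < γ ε ∧ γ ε < ε) ∧
    ∀ y : Fin 4 → Y, MY4 y →
      ∀ A : Finset (Fin 4), A.Nonempty →
        ∀ f : Y →L[ℝ] ℝ, ‖f‖ = 1 →
          (∀ i ∈ A, 1 - γ ε < f (y i)) →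
          ∃ z : Fin 4 → Y, MY4 z ∧ (∀ i, ‖z i - y i‖ < ε) ∧
            ‖∑ i ∈ A, z i‖ = (A.card : ℝ)

/-- In a normed space with a norm-one functional `g`, the vectors with `g x = ‖x‖` are closed under
finite sums. -/
lemma apply_sum_eq_norm {E ι : Type*} [NormedAddCommGroup E] [NormedSpace ℝ E]
    (g : E →L[ℝ] ℝ) (hg : ∀ x, g x ≤ ‖x‖) (s : Finset ι) (v : ι → E)
    (hv : ∀ i ∈ s, g (v i) = ‖v i‖) : g (∑ i ∈ s, v i) = ‖∑ i ∈ s, v i‖ := by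
  refine le_antisymm (hg _) ((norm_sum_le _ _).trans ?_)
  rw [map_sum]
  exact (Finset.sum_le_sum fun i hi => (hv i hi).ge)

/-- The two-vector case of `apply_sum_eq_norm`. -/
lemma apply_add_eq_norm {E : Type*} [NormedAddCommGroup E] [NormedSpace ℝ E]
    (g : E →L[ℝ] ℝ) (hg : ∀ x, g x ≤ ‖x‖) {x y : E} (hx : g x = ‖x‖) (hy : g y = ‖y‖) :
    g (x + y) = ‖x + y‖ := by
  refine le_antisymm (hg _) ((norm_add_le _ _).trans ?_)
  rw [map_add, hx, hy]

/-- Distance from `i` to the interval `[p, q]`. -/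
def intervalDist (p q i : Fin 4) : ℕ := (p.val - i.val) + (i.val - q.val)

/-- The value at the `i`-th vertex of a functional on `ℓ∞⁴` that exposes the face spanned by the
vertices with index in `[p, q]`. -/
noncomputable def faceFunctional (p q i : Fin 4) : ℝ :=
  1 - 2 * (intervalDist p q i : ℝ) / (4 - ((q : ℕ) - (p : ℕ) : ℝ))

lemma faceFunctional_eq_one {p q i : Fin 4} (hp : p ≤ i) (hq : i ≤ q) :
    faceFunctional p q i = 1 := by
  have : intervalDist p q i = 0 := by
    simp only [intervalDist]; omega
  simp [faceFunctional, this]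

lemma abs_one_sub_div_le {d D : ℝ} (h1 : 1 ≤ d) (h2 : d ≤ D - 1) (h4 : D ≤ 4) :
    |1 - 2 * d / D| ≤ 1 / 2 := by
  have hD : 0 < D := by linarith
  have e1 : 1 / 2 ≤ 2 * d / D := by rw [le_div_iff₀ hD]; linarith
  have e2 : 2 * d / D ≤ 3 / 2 := by rw [div_le_iff₀ hD]; linarith
  rw [abs_le]; constructor <;> linarith

lemma abs_faceFunctional_triple_le {p q i j k : Fin 4} (hpq : p ≤ q)
    (h : i = j ∧ j = k ∨ i < j ∧ j < k) (hn : ¬ (p ≤ i ∧ k ≤ q)) :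
    |faceFunctional p q i - faceFunctional p q j + faceFunctional p q k| ≤ 1 / 2 := by
  have hd : 1 + intervalDist p q j ≤ intervalDist p q i + intervalDist p q k ∧
      intervalDist p q i + intervalDist p q k + 1 + q.val
        ≤ intervalDist p q j + 4 + p.val := by
    simp only [intervalDist]; omega
  have h1 : (1 : ℝ) + intervalDist p q j ≤ intervalDist p q i + intervalDist p q k := by
    exact_mod_cast hd.1
  have h2 : (intervalDist p q i : ℝ) + intervalDist p q k + 1 + (q : ℕ)
      ≤ intervalDist p q j + 4 + (p : ℕ) := by
    exact_mod_cast hd.2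
  have h3 : ((p : ℕ) : ℝ) ≤ (q : ℕ) := by exact_mod_cast hpq
  have key := abs_one_sub_div_le
    (d := (intervalDist p q i : ℝ) - intervalDist p q j + intervalDist p q k)
    (D := 4 - ((q : ℕ) - (p : ℕ) : ℝ)) (by linarith) (by linarith) (by linarith)
  convert key using 2
  simp only [faceFunctional]
  ring

lemma MY4.norm_triple_le {Y : Type*} [NormedAddCommGroup Y] {y : Fin 4 → Y} (hy : MY4 y)
    {i j k : Fin 4} (hij : i ≤ j) (hjk : j ≤ k) : ‖y i - y j + y k‖ ≤ 1 := by
  rcases hij.eq_or_lt with rfl | hij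
  · simpa using hy.1 k
  rcases hjk.eq_or_lt with rfl | hjk
  · simpa using hy.1 i
  exact hy.2 i j k hij hjk

/-- Perturbation of a quadruple in `M_E^4` whose `p`-th and `q`-th members almost attain `1` at `g`
into one whose members with index in `[p, q]` all attain `1` at `g`. The positivity-like
hypothesis `hk` says that every vector can be corrected into the cone `{x | g x = ‖x‖}`. -/
lemma exists_MY4_attaining {E : Type*} [NormedAddCommGroup E] [NormedSpace ℝ E]
    (g : E →L[ℝ] ℝ) (hg : ∀ x, g x ≤ ‖x‖) (k : E → E) (hk0 : ∀ x, g (k x) = ‖k x‖)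
    (hk1 : ∀ x, g (x + k x) = ‖x + k x‖) (hk2 : ∀ x, ‖k x‖ ≤ ‖x‖ - g x)
    (e : E) (hge : g e = 1) (he : ‖e‖ = 1) {y : Fin 4 → E} (hy : MY4 y) {p q : Fin 4}
    (hpq : p ≤ q) {η : ℝ} (hη : 0 ≤ η) (hp : 1 - η ≤ g (y p)) (hq : 1 - η ≤ g (y q)) :
    ∃ z : Fin 4 → E, MY4 z ∧ (∀ i, ‖z i - y i‖ ≤ 538 * η) ∧
      ∀ i, p ≤ i → i ≤ q → g (z i) = 1 := by
  have hgy : ∀ i, p ≤ i → i ≤ q → 1 - 2 * η ≤ g (y i) := by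
    intro i hi hi'
    have h := (hg _).trans (hy.norm_triple_le hi hi')
    rw [map_add, map_sub] at h
    linarith
  have hgy' : ∀ i, g (y i) ≤ 1 := fun i => (hg _).trans (hy.1 i)
  have hsmul : ∀ (a : ℝ), 0 ≤ a → g (a • e) = ‖a • e‖ := by
    intro a ha
    rw [map_smul, norm_smul, hge, he, Real.norm_of_nonneg ha, smul_eq_mul]
  let x : Fin 4 × Fin 4 × Fin 4 → E := fun m => y m.1 - y m.2.1 + y m.2.2
  let F : Finset (Fin 4 × Fin 4 × Fin 4) :=
    Finset.univ.filter fun m => p ≤ m.1 ∧ m.1 ≤ m.2.1 ∧ m.2.1 ≤ m.2.2 ∧ m.2.2 ≤ q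
  let u : E := ∑ m ∈ F, k (x m)
  have hkx : ∀ m ∈ F, ‖k (x m)‖ ≤ 4 * η := by
    intro m hm
    obtain ⟨h1, h2, h3, h4⟩ := (Finset.mem_filter.1 hm).2
    have a1 := hgy m.1 h1 (h2.trans (h3.trans h4))
    have a2 := hgy m.2.2 (h1.trans (h2.trans h3)) h4
    have a3 := hgy' m.2.1
    have a4 := hy.norm_triple_le h2 h3
    have a5 := hk2 (x m)
    simp only [x, map_add, map_sub] at a5 ⊢
    linarith
  have hu : g u = ‖u‖ := apply_sum_eq_norm g hg _ _ fun m _ => hk0 _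
  have hu' : ‖u‖ ≤ 256 * η := by
    have hc : (F.card : ℝ) ≤ 64 := by
      have : F.card ≤ 64 := (Finset.card_le_univ F).trans (by simp)
      exact_mod_cast this
    have h : ‖u‖ ≤ F.card • (4 * η) :=
      (norm_sum_le _ _).trans (Finset.sum_le_card_nsmul _ _ _ hkx)
    rw [nsmul_eq_mul] at h
    nlinarith
  let U : E := u + (12 * η) • e
  have hU : g U = ‖U‖ := apply_add_eq_norm g hg hu (hsmul _ (by linarith))
  have hgU : g U = ‖u‖ + 12 * η := by
    simp only [U, map_add, map_smul, hu, hge, smul_eq_mul, mul_one]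
  have hu0 := norm_nonneg u
  let φ : Fin 4 → ℝ := faceFunctional p q
  let ψ : Fin 4 → ℝ := fun i => g (y (max p (min i q))) - 1
  have hψ : ∀ i, |ψ i| ≤ 2 * η := by
    intro i
    have a1 := hgy (max p (min i q)) (le_max_left _ _) (max_le hpq (min_le_right _ _))
    have a2 := hgy' (max p (min i q))
    rw [abs_le]; constructor <;> simp only [ψ] <;> linarith
  have hψF : ∀ i, p ≤ i → i ≤ q → ψ i = g (y i) - 1 := by
    intro i h1 h2
    simp only [ψ, min_eq_left h2, max_eq_right h1]
  have hφ : ∀ i, |φ i| ≤ 1 := by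
    intro i
    by_cases h : p ≤ i ∧ i ≤ q
    · simp only [φ, faceFunctional_eq_one h.1 h.2]; simp
    · have := abs_faceFunctional_triple_le hpq (Or.inl ⟨rfl, rfl⟩) h
      simp only [sub_self, zero_add] at this
      exact this.trans (by norm_num)
  let c : ℝ := 1 + ‖U‖
  have hc : 0 < c := by positivity
  let v : Fin 4 → E := fun i => y i + φ i • U - ψ i • e
  have hv : ∀ i j l, v i - v j + v l =
      (y i - y j + y l) + (φ i - φ j + φ l) • U - (ψ i - ψ j + ψ l) • e := by
    intro i j l
    simp only [v]
    module
  have hψ3 : ∀ i j l, |ψ i - ψ j + ψ l| ≤ 6 * η := by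
    intro i j l
    have h1 := abs_le.1 (hψ i)
    have h2 := abs_le.1 (hψ j)
    have h3 := abs_le.1 (hψ l)
    rw [abs_le]; constructor <;> linarith
  have hface : ∀ i j l, p ≤ i → i ≤ j → j ≤ l → l ≤ q →
      g (v i - v j + v l) = c ∧ ‖v i - v j + v l‖ = c := by
    intro i j l h1 h2 h3 h4
    have f1 : φ i = 1 := faceFunctional_eq_one h1 (h2.trans (h3.trans h4))
    have f2 : φ j = 1 := faceFunctional_eq_one (h1.trans h2) (h3.trans h4)
    have f3 : φ l = 1 := faceFunctional_eq_one (h1.trans (h2.trans h3)) h4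
    have g1 := hψF i h1 (h2.trans (h3.trans h4))
    have g2 := hψF j (h1.trans h2) (h3.trans h4)
    have g3 := hψF l (h1.trans (h2.trans h3)) h4
    have hm : (i, j, l) ∈ F := by simp [F, h1, h2, h3, h4]
    have e1 : g (v i - v j + v l) = c := by
      rw [hv, f1, f2, f3, g1, g2, g3]
      simp only [map_add, map_sub, map_smul, hge, hU, smul_eq_mul, c]
      ring
    refine ⟨e1, ?_⟩
    have hβ := abs_le.1 (hψ3 i j l)
    have hsplit : v i - v j + v l = ((x (i, j, l) + k (x (i, j, l))) +
        ∑ m ∈ F.erase (i, j, l), k (x m)) + (12 * η - (ψ i - ψ j + ψ l)) • e := by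
      rw [hv, f1, f2, f3]
      simp only [U, u]
      rw [← Finset.add_sum_erase F _ hm]
      simp only [x]
      module
    rw [← e1, hsplit]
    exact (apply_add_eq_norm g hg (apply_add_eq_norm g hg (hk1 _)
      (apply_sum_eq_norm g hg _ _ fun m _ => hk0 _)) (hsmul _ (by linarith))).symm
  have hbound : ∀ i j l, (i = j ∧ j = l ∨ i < j ∧ j < l) → ‖v i - v j + v l‖ ≤ c := by
    intro i j l h
    have hij : i ≤ j := h.elim (fun h => h.1.le) fun h => h.1.le
    have hjl : j ≤ l := h.elim (fun h => h.2.le) fun h => h.2.le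
    by_cases hF : p ≤ i ∧ l ≤ q
    · exact (hface i j l hF.1 hij hjl hF.2).2.le
    · have b1 : |φ i - φ j + φ l| ≤ 1 / 2 := abs_faceFunctional_triple_le hpq h hF
      have b2 := hψ3 i j l
      have b3 := hy.norm_triple_le hij hjl
      have b4 : ‖(φ i - φ j + φ l) • U‖ ≤ 1 / 2 * ‖U‖ := by
        rw [norm_smul, Real.norm_eq_abs]
        exact mul_le_mul_of_nonneg_right b1 (norm_nonneg _)
      have b5 : ‖(ψ i - ψ j + ψ l) • e‖ ≤ 6 * η := by
        rw [norm_smul, Real.norm_eq_abs, he, mul_one]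
        exact b2
      rw [hv]
      refine (norm_sub_le _ _).trans ?_
      have b6 := norm_add_le (y i - y j + y l) ((φ i - φ j + φ l) • U)
      simp only [c]
      linarith
  have hscale : ∀ w : E, ‖w‖ ≤ c → ‖c⁻¹ • w‖ ≤ 1 := by
    intro w hw
    rw [norm_smul, norm_inv, Real.norm_of_nonneg hc.le, inv_mul_le_one₀ hc]
    exact hw
  refine ⟨fun i => c⁻¹ • v i, ⟨fun i => ?_, fun i j l hij hjl => ?_⟩, fun i => ?_,
    fun i h1 h2 => ?_⟩
  · have := hbound i i i (Or.inl ⟨rfl, rfl⟩)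
    rw [sub_self, zero_add] at this
    exact hscale _ this
  · rw [← smul_sub, ← smul_add]
    exact hscale _ (hbound i j l (Or.inr ⟨hij, hjl⟩))
  · have hd : c⁻¹ • v i - y i = c⁻¹ • (φ i • U - ψ i • e - ‖U‖ • y i) := by
      have h : φ i • U - ψ i • e - ‖U‖ • y i = v i - c • y i := by
        simp only [v, c]
        module
      rw [h, smul_sub c⁻¹ (v i), inv_smul_smul₀ hc.ne']
    have d1 : ‖φ i • U‖ ≤ ‖U‖ := by
      rw [norm_smul, Real.norm_eq_abs]
      exact mul_le_of_le_one_left (norm_nonneg _) (hφ i)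
    have d2 : ‖ψ i • e‖ ≤ 2 * η := by
      rw [norm_smul, Real.norm_eq_abs, he, mul_one]
      exact hψ i
    have d3 : ‖‖U‖ • y i‖ ≤ ‖U‖ := by
      rw [norm_smul, norm_norm]
      exact mul_le_of_le_one_right (norm_nonneg _) (hy.1 i)
    have d4 := norm_sub_le (φ i • U - ψ i • e) (‖U‖ • y i)
    have d5 := norm_sub_le (φ i • U) (ψ i • e)
    have hc1 : c⁻¹ ≤ 1 := inv_le_one_of_one_le₀ (by simp [c])
    rw [hd, norm_smul, norm_inv, Real.norm_of_nonneg hc.le]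
    refine (mul_le_of_le_one_left (norm_nonneg _) hc1).trans ?_
    linarith
  · have := (hface i i i h1 le_rfl le_rfl h2).1
    rw [sub_self, zero_add] at this
    rw [map_smul, this, smul_eq_mul, inv_mul_cancel₀ hc.ne']

lemma hasSum_norm_lp_one (x : lp (fun _ : ℕ => ℝ) 1) : HasSum (fun n => |x n|) ‖x‖ := by
  have h := lp.hasSum_norm (p := 1) (by norm_num) x
  simpa using h

/-- For every functional `f` of norm one on `ℓ₁` there is a functional `g` with coefficients `±1`,
matching the signs of the coefficients of `f`, together with a map `k` correcting vectors into the
cone `{x | g x = ‖x‖}`. -/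
lemma exists_sign_functional (f : lp (fun _ : ℕ => ℝ) 1 →L[ℝ] ℝ) (hf : ‖f‖ = 1) :
    ∃ (g : lp (fun _ : ℕ => ℝ) 1 →L[ℝ] ℝ)
      (k : lp (fun _ : ℕ => ℝ) 1 → lp (fun _ : ℕ => ℝ) 1) (e : lp (fun _ : ℕ => ℝ) 1),
      (∀ x, g x ≤ ‖x‖) ∧ (∀ x, g (k x) = ‖k x‖) ∧ (∀ x, g (x + k x) = ‖x + k x‖) ∧
      (∀ x, ‖k x‖ ≤ ‖x‖ - g x) ∧ g e = 1 ∧ ‖e‖ = 1 ∧ ∀ x, f x ≤ (‖x‖ + g x) / 2 := by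
  let a : ℕ → ℝ := fun n => f (lp.single 1 n (1 : ℝ))
  let σ : ℕ → ℝ := fun n => if 0 ≤ a n then 1 else -1
  have hσ : ∀ n, σ n = 1 ∧ 0 ≤ a n ∨ σ n = -1 ∧ a n ≤ 0 := by
    intro n
    by_cases h : 0 ≤ a n
    · left; simp [σ, h]
    · right; simp [σ, h, (not_le.1 h).le]
  have hσabs : ∀ n, |σ n| = 1 := by
    intro n; rcases hσ n with h | h <;> simp [h.1]
  have hσσ : ∀ n, σ n * σ n = 1 := by
    intro n; rcases hσ n with h | h <;> simp [h.1]
  have ha : ∀ n, |a n| ≤ 1 := by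
    intro n
    have h := f.le_opNorm (lp.single 1 n (1 : ℝ))
    rwa [hf, lp.norm_single (by norm_num), norm_one, mul_one] at h
  have hsum : ∀ x : lp (fun _ : ℕ => ℝ) 1, Summable fun n => σ n * x n := by
    intro x
    refine (hasSum_norm_lp_one x).summable.of_norm_bounded fun n => ?_
    rw [norm_mul, Real.norm_eq_abs, hσabs, one_mul, Real.norm_eq_abs]
  let g₀ : lp (fun _ : ℕ => ℝ) 1 →ₗ[ℝ] ℝ :=
    { toFun := fun x => ∑' n, σ n * x n
      map_add' := fun x y => by
        rw [← (hsum x).tsum_add (hsum y)]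
        exact tsum_congr fun n => by rw [lp.coeFn_add, Pi.add_apply, mul_add]
      map_smul' := fun r x => by
        rw [RingHom.id_apply, smul_eq_mul, ← tsum_mul_left]
        exact tsum_congr fun n => by
          rw [lp.coeFn_smul, Pi.smul_apply, smul_eq_mul]; ring }
  have hbd : ∀ x, ‖g₀ x‖ ≤ 1 * ‖x‖ := by
    intro x
    rw [one_mul]
    refine tsum_of_norm_bounded (hasSum_norm_lp_one x) fun n => ?_
    rw [norm_mul, Real.norm_eq_abs, hσabs, one_mul, Real.norm_eq_abs]
  let g : lp (fun _ : ℕ => ℝ) 1 →L[ℝ] ℝ := g₀.mkContinuous 1 hbd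
  have hgs : ∀ x, HasSum (fun n => σ n * x n) (g x) := fun x => (hsum x).hasSum
  have hpos : ∀ x : lp (fun _ : ℕ => ℝ) 1, (∀ n, 0 ≤ σ n * x n) → g x = ‖x‖ := by
    intro x hx
    refine (hgs x).unique ?_
    convert hasSum_norm_lp_one x using 2 with n
    rw [← abs_of_nonneg (hx n), abs_mul, hσabs, one_mul]
  have hmem : ∀ x : lp (fun _ : ℕ => ℝ) 1, Memℓp (fun n => σ n * |x n|) 1 := by
    intro x
    refine memℓp_gen ?_
    simpa [abs_mul, hσabs] using (hasSum_norm_lp_one x).summable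
  let R : lp (fun _ : ℕ => ℝ) 1 → lp (fun _ : ℕ => ℝ) 1 := fun x => ⟨_, hmem x⟩
  have hR : ∀ x n, R x n = σ n * |x n| := fun x n => rfl
  have hRpos : ∀ x, g (R x) = ‖R x‖ := by
    intro x
    refine hpos _ fun n => ?_
    rw [hR, ← mul_assoc, hσσ, one_mul]
    exact abs_nonneg _
  have hRg : ∀ x, g (R x) = ‖x‖ := by
    intro x
    refine (hgs _).unique ?_
    convert hasSum_norm_lp_one x using 2 with n
    rw [hR, ← mul_assoc, hσσ, one_mul]
  have hkpos : ∀ x, g (R x - x) = ‖R x - x‖ := by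
    intro x
    refine hpos _ fun n => ?_
    rw [lp.coeFn_sub, Pi.sub_apply, hR, mul_sub, ← mul_assoc, hσσ, one_mul, sub_nonneg]
    refine (le_abs_self _).trans ?_
    rw [abs_mul, hσabs, one_mul]
  have hsingle : ∀ n, ‖lp.single (E := fun _ : ℕ => ℝ) 1 n (σ n)‖ = 1 := by
    intro n
    rw [lp.norm_single (by norm_num), Real.norm_eq_abs, hσabs]
  refine ⟨g, fun x => R x - x, lp.single 1 0 (σ 0), fun x => ?_, hkpos, fun x => ?_, fun x => ?_,
    ?_, hsingle 0, fun x => ?_⟩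
  · exact ((le_abs_self _).trans (hbd x)).trans_eq (one_mul _)
  · rw [add_sub_cancel]
    exact hRpos x
  · rw [← hkpos, map_sub, hRg]
  · rw [← hsingle 0]
    refine hpos _ fun n => ?_
    rcases eq_or_ne n 0 with rfl | hn
    · simp [hσσ]
    · simp [hn]
  · have h1 := (lp.hasSum_single (p := 1) (by norm_num) x).mapL f
    have h2 := ((hasSum_norm_lp_one x).add (hgs x)).div_const 2
    refine hasSum_le (fun n => ?_) h1 h2
    have hfa : f (lp.single 1 n (x n)) = x n * a n := by
      have : lp.single (E := fun _ : ℕ => ℝ) 1 n (x n) = x n • lp.single 1 n (1 : ℝ) := by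
        rw [← lp.single_smul, smul_eq_mul, mul_one]
      rw [this, map_smul, smul_eq_mul]
    rw [hfa]
    have hn := abs_le.1 (ha n)
    rcases hσ n with h | h <;> rw [h.1] <;> rcases abs_cases (x n) with h' | h' <;>
      rw [h'.1] <;> nlinarith

/-- The real space `ℓ₁` of absolutely summable sequences has the AHSp-`ℓ∞⁴`. -/
theorem stmt16 : ∃ γ : ℝ → ℝ, AHSpL4With (lp (fun _ : ℕ => ℝ) 1) γ := by
  refine ⟨fun ε => ε / 2000, fun ε hε _ => ⟨⟨by positivity, by linarith⟩, ?_⟩⟩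
  intro y hy A hA f hf hfA
  obtain ⟨g, k, e, hg, hk0, hk1, hk2, hge, he, hfg⟩ := exists_sign_functional f hf
  have hgA : ∀ i ∈ A, 1 - ε / 1000 ≤ g (y i) := by
    intro i hi
    have h1 := hfA i hi
    have h2 := hfg (y i)
    have h3 := hy.1 i
    linarith
  obtain ⟨z, hz, hzy, hgz⟩ := exists_MY4_attaining g hg k hk0 hk1 hk2 e hge he hy
    (A.min'_le_max' hA) (by positivity) (hgA _ (A.min'_mem hA)) (hgA _ (A.max'_mem hA))
  refine ⟨z, hz, fun i => (hzy i).trans_lt (by linarith), le_antisymm ?_ ?_⟩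
  · refine (norm_sum_le _ _).trans ((Finset.sum_le_card_nsmul A _ 1 fun i _ => hz.1 i).trans ?_)
    simp
  · refine le_trans ?_ (hg _)
    rw [map_sum, Finset.sum_congr rfl fun i hi => hgz i (A.min'_le i hi) (A.le_max' i hi)]
    simp
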